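/- (Translation formula for Eisenstein series, constant-free part) Let ψ be a Dirichlet character mod N_ψ with ψ(−1) = −1, let r = a/c with gcd(a,c)=1, and ω = e^{2πir}. Then ∑_{m≥1} ψ(m) m² ω^m q^m/(1 − ω^m q^m) = ∑_{c = c₁c₂c₃} ∑_{χ ∈ ((ℤ/c₃ℤ)^×)^∧} (χ(a) g(χ̄) ψ(c₁) c₁² / φ(c₃)) · ∑_{m'≥1} (1_{c₂c₃}χψ)(m') m'² ∑_{n'=1}^{c₃} χ(n') (q^{c₁c₂})^{n'm'}/(1 − (q^{c₁c₂})^{c₃m'}), as formal power series in q. -/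

import Mathlib

open Complex DirichletCharacter

/-- The Gauss sum `g(χ̄) = ∑_{ν mod n} χ̄(ν) e^{2πiν/n}` of the conjugate character. -/
noncomputable def gaussSumConj {n : ℕ} (χ : DirichletCharacter ℂ n) : ℂ :=
  ∑ ν ∈ Finset.range n,
    (starRingEnd ℂ) (χ (ν : ZMod n)) * Complex.exp (2 * Real.pi * Complex.I * ν / n)

theorem gaussSumConj_eq_sum_zmod {n : ℕ} [NeZero n] (χ : DirichletCharacter ℂ n) :
    gaussSumConj χ = ∑ ν : ZMod n, χ⁻¹ ν * ZMod.stdAddChar ν := by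
  unfold gaussSumConj
  refine Finset.sum_bij' (fun ν _ => (ν : ZMod n)) (fun ν _ => ν.val) ?_ ?_ ?_ ?_ ?_
  · simp
  · intro ν _
    exact Finset.mem_range.2 ν.val_lt
  · intro ν hν
    exact ZMod.val_cast_of_lt (Finset.mem_range.1 hν)
  · simp
  · intro ν _
    have h := ZMod.stdAddChar_coe (N := n) (ν : ℤ)
    push_cast at h
    rw [h, ← MulChar.star_apply']
    rfl

/-- Expansion of an additive character at a unit in terms of multiplicative characters. -/
theorem stdAddChar_eq_sum_dirichletCharacter {n : ℕ} [NeZero n] {x : ZMod n} (hx : IsUnit x) :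
    ZMod.stdAddChar x =
      ∑ χ : DirichletCharacter ℂ n, χ x * gaussSumConj χ / (n.totient : ℂ) := by
  have hn : (n.totient : ℂ) ≠ 0 := by
    exact_mod_cast (Nat.totient_pos.2 (NeZero.pos n)).ne'
  rw [← Finset.sum_div, eq_div_iff hn]
  simp_rw [gaussSumConj_eq_sum_zmod, Finset.mul_sum]
  rw [Finset.sum_comm]
  have key : ∀ ν : ZMod n, ∑ χ : DirichletCharacter ℂ n, χ x * (χ⁻¹ ν * ZMod.stdAddChar ν) =
      (if x = ν then (n.totient : ℂ) else 0) * ZMod.stdAddChar ν := by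
    intro ν
    rw [← Equiv.sum_comp (Equiv.inv (DirichletCharacter ℂ n))]
    simp only [Equiv.inv_apply, inv_inv, ← mul_assoc]
    rw [← Finset.sum_mul, ← sum_char_inv_mul_char_eq ℂ hx ν]
    congr 1
    refine Finset.sum_congr rfl fun χ _ => ?_
    obtain ⟨u, rfl⟩ := hx
    rw [MulChar.inv_apply, Ring.inverse_unit, ZMod.inv_coe_unit]
  rw [Finset.sum_congr rfl fun ν _ => key ν]
  simp [mul_comm]

/-- Partial-fraction form of a geometric series twisted by a root of unity. -/
theorem twisted_geometric_eq_sum {ζ y : ℂ} {k : ℕ} (hζ : ζ ^ k = 1) (hy : y ^ k ≠ 1) :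
    ζ * y / (1 - ζ * y) = ∑ j ∈ Finset.Icc 1 k, ζ ^ j * y ^ j / (1 - y ^ k) := by
  have hk : (ζ * y) ^ k = y ^ k := by rw [mul_pow, hζ, one_mul]
  have h1 : 1 - ζ * y ≠ 0 := by
    intro h
    apply hy
    rw [← hk, ← sub_eq_zero.1 h, one_pow]
  have h2 : 1 - y ^ k ≠ 0 := sub_ne_zero.2 hy.symm
  rw [← Finset.sum_div, div_eq_div_iff h1 h2, ← hk, ← mul_neg_geom_sum]
  simp_rw [← mul_pow]
  rw [← Finset.Ico_add_one_right_eq_Icc, Finset.sum_Ico_eq_sum_range]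
  simp only [add_tsub_cancel_right, pow_add, pow_one, ← Finset.mul_sum]
  ring

/-- Splitting a sum over `1, …, k` according to the greatest common divisor with `k`. -/
theorem sum_Icc_eq_sum_divisorsAntidiagonal {M : Type*} [AddCommMonoid M] {k : ℕ} (hk : 0 < k)
    (f : ℕ → M) :
    ∑ j ∈ Finset.Icc 1 k, f j = ∑ t ∈ k.divisorsAntidiagonal,
      ∑ n ∈ Finset.Icc 1 t.2, if n.Coprime t.2 then f (t.1 * n) else 0 := by
  simp_rw [← Finset.sum_filter]
  rw [Finset.sum_sigma']
  refine Finset.sum_bij' (fun j _ => ⟨(j.gcd k, k / j.gcd k), j / j.gcd k⟩)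
    (fun s _ => s.1.1 * s.2) ?_ ?_ ?_ ?_ ?_
  · intro j hj
    obtain ⟨h1, h2⟩ := Finset.mem_Icc.1 hj
    have hg : 0 < j.gcd k := Nat.gcd_pos_of_pos_right j hk
    simp only [Finset.mem_sigma, Nat.mem_divisorsAntidiagonal, Finset.mem_filter, Finset.mem_Icc]
    exact ⟨⟨Nat.mul_div_cancel' (Nat.gcd_dvd_right j k), hk.ne'⟩,
      ⟨Nat.div_pos (Nat.gcd_le_left k h1) hg, Nat.div_le_div_right h2⟩,
      Nat.coprime_div_gcd_div_gcd hg⟩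
  · rintro ⟨⟨d, e⟩, n⟩ hs
    simp only [Finset.mem_sigma, Nat.mem_divisorsAntidiagonal, Finset.mem_filter,
      Finset.mem_Icc] at hs ⊢
    obtain ⟨⟨rfl, -⟩, ⟨h1, h2⟩, -⟩ := hs
    exact ⟨Nat.mul_pos (Nat.pos_of_mul_pos_right hk) h1, Nat.mul_le_mul_left d h2⟩
  · intro j _
    exact Nat.mul_div_cancel' (Nat.gcd_dvd_left j k)
  · rintro ⟨⟨d, e⟩, n⟩ hs
    simp only [Finset.mem_sigma, Nat.mem_divisorsAntidiagonal, Finset.mem_filter,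
      Finset.mem_Icc] at hs ⊢
    obtain ⟨⟨rfl, -⟩, -, h⟩ := hs
    have hd : 0 < d := Nat.pos_of_mul_pos_right hk
    have hg : (d * n).gcd (d * e) = d := by rw [Nat.gcd_mul_left, h.gcd_eq_one, mul_one]
    simp [hg, Nat.mul_div_cancel_left _ hd]
  · intro j _
    simp only [Nat.mul_div_cancel' (Nat.gcd_dvd_left j k)]

/-- Splitting a series over the positive integers according to the greatest common divisor of the
index with `c`. -/
theorem tsum_succ_eq_sum_divisorsAntidiagonal {f : ℕ → ℂ} {c : ℕ} (hc : 0 < c)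
    (hf : Summable fun m => f (m + 1)) :
    ∑' m, f (m + 1) = ∑ p ∈ c.divisorsAntidiagonal,
      ∑' m, if (m + 1).Coprime p.2 then f (p.1 * (m + 1)) else 0 := by
  have hsplit : ∀ m, f (m + 1) =
      ∑ p ∈ c.divisorsAntidiagonal, if (m + 1).gcd c = p.1 then f (m + 1) else 0 := by
    intro m
    rw [Nat.sum_divisorsAntidiagonal fun d _ => if (m + 1).gcd c = d then f (m + 1) else 0]
    simp [hc.ne', Nat.gcd_dvd_right]
  rw [tsum_congr hsplit, Summable.tsum_finsetSum]
  · refine Finset.sum_congr rfl fun ⟨d, e⟩ hp => ?_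
    obtain ⟨rfl, -⟩ := Nat.mem_divisorsAntidiagonal.1 hp
    have hd : 0 < d := Nat.pos_of_mul_pos_right hc
    have hinj : Function.Injective fun m : ℕ => d * (m + 1) - 1 := by
      intro m n hmn
      have h1 : 0 < d * (m + 1) := by positivity
      have h2 : 0 < d * (n + 1) := by positivity
      have h3 : d * (m + 1) = d * (n + 1) := by simp only at hmn; omega
      exact Nat.succ_injective (Nat.eq_of_mul_eq_mul_left hd h3)
    rw [← hinj.tsum_eq]
    · refine tsum_congr fun m => ?_
      have h1 : d * (m + 1) - 1 + 1 = d * (m + 1) := Nat.sub_add_cancel (Nat.mul_pos hd m.succ_pos)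
      simp only [h1, Nat.gcd_mul_left, Nat.mul_eq_left hd.ne', Nat.Coprime]
    · intro m hm
      have hg : (m + 1).gcd (d * e) = d := by
        by_contra h
        simp [h] at hm
      obtain ⟨n, hn⟩ : d ∣ m + 1 := hg ▸ Nat.gcd_dvd_left _ _
      rcases n with _ | n
      · simp at hn
      · exact ⟨n, by simp only; omega⟩
  · intro p _
    refine Summable.of_norm_bounded hf.norm fun m => ?_
    split_ifs <;> simp

theorem summable_of_norm_le_sq_mul_geometric {f : ℕ → ℂ} {r C : ℝ} (hr0 : 0 ≤ r) (hr : r < 1)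
    (hf : ∀ m, ‖f m‖ ≤ C * (((m + 1 : ℕ) : ℝ) ^ 2 * r ^ (m + 1))) : Summable f := by
  have h := summable_pow_mul_geometric_of_norm_lt_one 2
    (show ‖r‖ < 1 by rwa [Real.norm_of_nonneg hr0])
  exact Summable.of_norm_bounded (((summable_nat_add_iff 1).2 h).mul_left C) hf

theorem norm_div_one_sub_le {x y : ℂ} {r : ℝ} {m : ℕ} (hr : r < 1)
    (hx : ‖x‖ ≤ r ^ (m + 1)) (hy : ‖y‖ ≤ r) : ‖x / (1 - y)‖ ≤ (1 - r)⁻¹ * r ^ (m + 1) := by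
  have h1 : 1 - r ≤ ‖1 - y‖ := by
    have := norm_sub_norm_le (1 : ℂ) y
    rw [norm_one] at this
    linarith
  rw [norm_div, div_eq_inv_mul]
  have h2 : 0 < 1 - r := by linarith
  gcongr

/-- The Lambert series term at the twisted argument `ω q`, expanded in Dirichlet characters. -/
theorem lambert_term_eq_sum_dirichletCharacter {a : ℤ} {d k m : ℕ} (hd : 0 < d) (hk : 0 < k)
    (hm : 0 < m) (hak : IsCoprime a (k : ℤ)) (hmk : m.Coprime k) {q ω : ℂ} (hq : ‖q‖ < 1)
    (hω : ω = Complex.exp (2 * Real.pi * Complex.I * a / (d * k : ℕ))) :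
    ω ^ (d * m) * q ^ (d * m) / (1 - ω ^ (d * m) * q ^ (d * m)) =
      ∑ t ∈ k.divisorsAntidiagonal, ∑ χ : DirichletCharacter ℂ t.2,
        χ (a : ZMod t.2) * gaussSumConj χ / (t.2.totient : ℂ) * (χ (m : ZMod t.2) *
          ∑ n ∈ Finset.Icc 1 t.2, χ (n : ZMod t.2) * (q ^ (d * t.1)) ^ (n * m) /
            (1 - (q ^ (d * t.1)) ^ (t.2 * m))) := by
  have hdC : (d : ℂ) ≠ 0 := by exact_mod_cast hd.ne'
  have hkC : (k : ℂ) ≠ 0 := by exact_mod_cast hk.ne'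
  have hζ : (ω ^ (d * m)) ^ k = 1 := by
    rw [← pow_mul, hω, ← Complex.exp_nat_mul, Complex.exp_eq_one_iff]
    refine ⟨a * m, ?_⟩
    push_cast
    field_simp
  have hy : (q ^ (d * m)) ^ k ≠ 1 := by
    rw [← pow_mul]
    intro h
    have h1 : ‖q ^ (d * m * k)‖ < 1 := by
      rw [norm_pow]
      exact pow_lt_one₀ (norm_nonneg q) hq (by positivity)
    simp [h] at h1
  rw [twisted_geometric_eq_sum hζ hy, sum_Icc_eq_sum_divisorsAntidiagonal hk]
  refine Finset.sum_congr rfl fun ⟨e, l⟩ ht => ?_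
  obtain ⟨rfl, -⟩ := Nat.mem_divisorsAntidiagonal.1 ht
  have he : 0 < e := Nat.pos_of_mul_pos_right hk
  have hl : 0 < l := Nat.pos_of_mul_pos_left hk
  have heC : (e : ℂ) ≠ 0 := by exact_mod_cast he.ne'
  have hlC : (l : ℂ) ≠ 0 := by exact_mod_cast hl.ne'
  have : NeZero l := ⟨hl.ne'⟩
  have hua : IsUnit (a : ZMod l) := by
    rw [ZMod.coe_int_isUnit_iff_isCoprime]
    push_cast at hak
    exact hak.of_mul_right_right.symm
  have hum : IsUnit (m : ZMod l) :=
    (ZMod.isUnit_iff_coprime m l).2 (hmk.coprime_dvd_right (dvd_mul_left l e))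
  simp only [Finset.mul_sum]
  rw [Finset.sum_comm]
  refine Finset.sum_congr rfl fun n _ => ?_
  have hQ1 : (q ^ (d * e)) ^ (n * m) = (q ^ (d * m)) ^ (e * n) := by
    rw [← pow_mul, ← pow_mul]; congr 1; ring
  have hQ2 : (q ^ (d * e)) ^ (l * m) = (q ^ (d * m)) ^ (e * l) := by
    rw [← pow_mul, ← pow_mul]; congr 1; ring
  simp only [hQ1, hQ2]
  split_ifs with hn
  · have hun : IsUnit (n : ZMod l) := (ZMod.isUnit_iff_coprime n l).2 hn
    have hexp : (ω ^ (d * m)) ^ (e * n) = ZMod.stdAddChar ((a : ZMod l) * (m : ZMod l) * (n : ZMod l)) := by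
      have h := ZMod.stdAddChar_coe (N := l) (a * m * n)
      push_cast at h
      rw [h, ← pow_mul, hω, ← Complex.exp_nat_mul]
      congr 1
      push_cast
      field_simp
    rw [hexp, stdAddChar_eq_sum_dirichletCharacter ((hua.mul hum).mul hun), Finset.sum_mul,
      Finset.sum_div]
    refine Finset.sum_congr rfl fun χ _ => ?_
    rw [map_mul, map_mul]
    ring
  · have hun : ¬ IsUnit (n : ZMod l) := fun h => hn ((ZMod.isUnit_iff_coprime n l).1 h)
    simp [MulChar.map_nonunit _ hun]

/-- Translation formula for Eisenstein series, constant-free part.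
Let `ψ` be an odd Dirichlet character, `r = a/c` with `gcd(a,c) = 1` and `ω = e^{2πir}`. Then
`∑_{m≥1} ψ(m) m² ω^m q^m/(1 − ω^m q^m)` equals
`∑_{c=c₁c₂c₃} ∑_{χ mod c₃} (χ(a) g(χ̄) ψ(c₁) c₁²/φ(c₃)) ·
∑_{m'≥1} (1_{c₂c₃}χψ)(m') m'² ∑_{n'=1}^{c₃} χ(n') Q^{n'm'}/(1 − Q^{c₃m'})` with `Q = q^{c₁c₂}`. -/
theorem eisenstein_translation_formula
    {Nψ : ℕ} [NeZero Nψ] (ψ : DirichletCharacter ℂ Nψ) (hψ : ψ (-1) = -1)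
    (a : ℤ) (c : ℕ) (hc : 0 < c) (hgcd : a.gcd c = 1)
    (q : ℂ) (hq : ‖q‖ < 1)
    (ω : ℂ) (hω : ω = Complex.exp (2 * Real.pi * Complex.I * a / c)) :
    ∑' m : ℕ,
        ψ ((m + 1 : ℕ) : ZMod Nψ) * ((m : ℂ) + 1) ^ 2 *
          (ω ^ (m + 1) * q ^ (m + 1)) / (1 - ω ^ (m + 1) * q ^ (m + 1)) =
      ∑ p ∈ Nat.divisorsAntidiagonal c,
        ∑ t ∈ Nat.divisorsAntidiagonal p.2,
          ∑ χ : DirichletCharacter ℂ t.2,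
            χ ((a : ZMod t.2)) * gaussSumConj χ * ψ ((p.1 : ℕ) : ZMod Nψ) * (p.1 : ℂ) ^ 2 /
                (Nat.totient t.2 : ℂ) *
              ∑' m' : ℕ,
                (if Nat.Coprime (m' + 1) (t.1 * t.2) then (1 : ℂ) else 0) *
                    χ (((m' + 1 : ℕ) : ZMod t.2)) * ψ (((m' + 1 : ℕ) : ZMod Nψ)) *
                    ((m' : ℂ) + 1) ^ 2 *
                  ∑ n' ∈ Finset.Icc 1 t.2,
                    χ ((n' : ZMod t.2)) * (q ^ (p.1 * t.1)) ^ (n' * (m' + 1)) /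
                      (1 - (q ^ (p.1 * t.1)) ^ (t.2 * (m' + 1))) := by
  have hq0 : 0 ≤ ‖q‖ := norm_nonneg q
  have hpow : ∀ {i j : ℕ}, i ≤ j → ‖q‖ ^ j ≤ ‖q‖ ^ i := fun h =>
    pow_le_pow_of_le_one hq0 hq.le h
  have hnormω : ‖ω‖ = 1 := by
    rw [hω, Complex.norm_exp]
    simp [Complex.div_re]
  let f : ℕ → ℂ := fun m => ψ (m : ZMod Nψ) * (m : ℂ) ^ 2 *
    (ω ^ m * q ^ m / (1 - ω ^ m * q ^ m))
  have hLHS : ∀ m : ℕ, ψ ((m + 1 : ℕ) : ZMod Nψ) * ((m : ℂ) + 1) ^ 2 *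
      (ω ^ (m + 1) * q ^ (m + 1)) / (1 - ω ^ (m + 1) * q ^ (m + 1)) = f (m + 1) := by
    intro m
    simp only [f, Nat.cast_add, Nat.cast_one, mul_div_assoc]
  have hf : Summable fun m => f (m + 1) := by
    refine summable_of_norm_le_sq_mul_geometric (C := (1 - ‖q‖)⁻¹) hq0 hq fun m => ?_
    have h1 : ‖ω ^ (m + 1) * q ^ (m + 1)‖ = ‖q‖ ^ (m + 1) := by simp [hnormω]
    have h2 := norm_div_one_sub_le hq h1.le
      (h1.le.trans ((hpow (Nat.le_add_left 1 m)).trans_eq (pow_one _)))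
    simp only [f]
    rw [norm_mul, norm_mul, norm_pow, Complex.norm_natCast]
    calc _ ≤ 1 * ((m + 1 : ℕ) : ℝ) ^ 2 * ((1 - ‖q‖)⁻¹ * ‖q‖ ^ (m + 1)) := by
          gcongr
          exact ψ.norm_le_one _
      _ = _ := by ring
  rw [tsum_congr hLHS, tsum_succ_eq_sum_divisorsAntidiagonal hc hf]
  refine Finset.sum_congr rfl fun ⟨d, k⟩ hp => ?_
  obtain ⟨rfl, -⟩ := Nat.mem_divisorsAntidiagonal.1 hp
  have hd : 0 < d := Nat.pos_of_mul_pos_right hc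
  have hk : 0 < k := Nat.pos_of_mul_pos_left hc
  have hak : IsCoprime a (k : ℤ) := by
    have h := Int.isCoprime_iff_gcd_eq_one.2 hgcd
    push_cast at h
    exact h.of_mul_right_right
  have hsum : ∀ t ∈ k.divisorsAntidiagonal, ∀ χ : DirichletCharacter ℂ t.2,
      Summable fun m : ℕ => (if Nat.Coprime (m + 1) (t.1 * t.2) then (1 : ℂ) else 0) *
        χ (((m + 1 : ℕ) : ZMod t.2)) * ψ (((m + 1 : ℕ) : ZMod Nψ)) * ((m : ℂ) + 1) ^ 2 *
          ∑ n ∈ Finset.Icc 1 t.2, χ ((n : ZMod t.2)) * (q ^ (d * t.1)) ^ (n * (m + 1)) /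
            (1 - (q ^ (d * t.1)) ^ (t.2 * (m + 1))) := by
    rintro ⟨e, l⟩ ht χ
    obtain ⟨rfl, -⟩ := Nat.mem_divisorsAntidiagonal.1 ht
    have he : 0 < e := Nat.pos_of_mul_pos_right hk
    have hl : 0 < l := Nat.pos_of_mul_pos_left hk
    refine summable_of_norm_le_sq_mul_geometric (C := l * (1 - ‖q‖)⁻¹) hq0 hq fun m => ?_
    have h1 : ‖∑ n ∈ Finset.Icc 1 l, χ ((n : ZMod l)) * (q ^ (d * e)) ^ (n * (m + 1)) /
        (1 - (q ^ (d * e)) ^ (l * (m + 1)))‖ ≤ l * ((1 - ‖q‖)⁻¹ * ‖q‖ ^ (m + 1)) := by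
      refine (norm_sum_le_of_le _ (n := fun _ => (1 - ‖q‖)⁻¹ * ‖q‖ ^ (m + 1)) fun n hn =>
        norm_div_one_sub_le hq ?_ ?_).trans_eq (by simp)
      · rw [norm_mul, ← pow_mul, norm_pow]
        refine (mul_le_of_le_one_left (by positivity) (χ.norm_le_one _)).trans (hpow ?_)
        have hn1 := (Finset.mem_Icc.1 hn).1
        rw [← mul_assoc]
        exact Nat.le_mul_of_pos_left _ (by positivity)
      · rw [← pow_mul, norm_pow]
        exact (hpow (Nat.one_le_iff_ne_zero.2 (by positivity))).trans_eq (pow_one _)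
    have h2 : ‖(if Nat.Coprime (m + 1) (e * l) then (1 : ℂ) else 0)‖ ≤ 1 := by
      split_ifs <;> simp
    have h3 : ‖(m : ℂ) + 1‖ = ((m + 1 : ℕ) : ℝ) := by
      rw [← Complex.norm_natCast]; simp
    rw [norm_mul, norm_mul, norm_mul, norm_mul, norm_pow, h3]
    calc _ ≤ 1 * 1 * 1 * ((m + 1 : ℕ) : ℝ) ^ 2 * (l * ((1 - ‖q‖)⁻¹ * ‖q‖ ^ (m + 1))) := by
          gcongr
          · exact χ.norm_le_one _
          · exact ψ.norm_le_one _
      _ = _ := by ring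
  simp_rw [← tsum_mul_left]
  rw [Finset.sum_congr rfl fun t ht =>
    (Summable.tsum_finsetSum fun χ _ => (hsum t ht χ).mul_left _).symm,
    ← Summable.tsum_finsetSum fun t ht => summable_sum fun χ _ => (hsum t ht χ).mul_left _]
  refine tsum_congr fun m => ?_
  split_ifs with hm
  · simp only [f]
    rw [lambert_term_eq_sum_dirichletCharacter hd hk m.succ_pos hak hm hq hω, Finset.mul_sum]
    refine Finset.sum_congr rfl fun t ht => ?_
    rw [Finset.mul_sum]
    refine Finset.sum_congr rfl fun χ _ => ?_
    rw [(Nat.mem_divisorsAntidiagonal.1 ht).1, if_pos hm]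
    push_cast
    rw [map_mul]
    ring
  · refine (Finset.sum_eq_zero fun t ht => Finset.sum_eq_zero fun χ _ => ?_).symm
    rw [(Nat.mem_divisorsAntidiagonal.1 ht).1, if_neg hm]
    ring
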